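/- Every non-meager (second category) subset G of (cl(CP), ρ) contains uncountably many pairwise non-conjugate maps. Moreover, there exist perfectly many conjugacy classes in cl(CP): there is a perfect subset A ⊆ cl(CP) such that any two distinct elements of A are not topologically conjugate. -/

import Mathlib

open Set Function Metric

/-- The unit interval `[0,1]` with the Euclidean metric. -/
abbrev unitI : Type := Set.Icc (0:ℝ) 1

/-- `CP`: continuous surjective self-maps of `I` with a dense set of periodic points.
The ambient space `C(I,I)` carries the uniform (sup) metric. -/
def CP : Set C(unitI, unitI) :=
  {f | Function.Surjective ⇑f ∧ Dense (Function.periodicPts ⇑f)}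

/-- `f` is topologically conjugate to `g` via a homeomorphism of `I`. -/
def ConjugateTo (f g : C(unitI, unitI)) : Prop :=
  ∃ ψ : unitI ≃ₜ unitI, ∀ x, g x = ψ.symm (f (ψ x))

/-- `φ` is a continuous right inverse on `t` of the iterate `G^[L]`, with values in `s`. -/
def IsInverseBranch (G : ℝ → ℝ) (L : ℕ) (s t : Set ℝ) (φ : ℝ → ℝ) : Prop :=
  ContinuousOn φ t ∧ MapsTo φ t s ∧ ∀ y ∈ t, G^[L] (φ y) = y

lemma IsInverseBranch.comp {G : ℝ → ℝ} {L L' : ℕ} {s t u : Set ℝ} {φ φ' : ℝ → ℝ}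
    (h : IsInverseBranch G L s t φ) (h' : IsInverseBranch G L' t u φ') :
    IsInverseBranch G (L' + L) s u (φ ∘ φ') := by
  refine ⟨h.1.comp h'.1 h'.2.1, h.2.1.comp h'.2.1, fun y hy => ?_⟩
  rw [iterate_add_apply, comp_apply, h.2.2 _ (h'.2.1 hy), h'.2.2 y hy]

lemma isInverseBranch_zero (G : ℝ → ℝ) (s : Set ℝ) : IsInverseBranch G 0 s s id :=
  ⟨continuousOn_id, mapsTo_id s, fun _ _ => rfl⟩

/-- An expanding Markov map whose transition graph has symmetric reachability has periodic points
arbitrarily close to every point of the Markov blocks. -/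
theorem exists_periodic_near_of_markov {ι : Type*} {G : ℝ → ℝ} {a b : ι → ℝ} {E : ι → ι → Prop}
    (hlen : ∀ i, b i ≤ a i + 1)
    (hpoint : ∀ i, ∀ x ∈ Icc (a i) (b i), ∃ j φ, E i j ∧ G x ∈ Icc (a j) (b j) ∧
      IsInverseBranch G 1 (Icc (a i) (b i)) (Icc (a j) (b j)) φ ∧
      ∀ y ∈ Icc (a j) (b j), |φ y - x| ≤ |y - G x| / 2)
    (hedge : ∀ i j, E i j → ∃ φ, IsInverseBranch G 1 (Icc (a i) (b i)) (Icc (a j) (b j)) φ)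
    (hsymm : ∀ i j, E i j → Relation.ReflTransGen E j i)
    {i : ι} {x : ℝ} (hx : x ∈ Icc (a i) (b i)) {ε : ℝ} (hε : 0 < ε) :
    ∃ p ∈ Icc (a i) (b i), p ∈ periodicPts G ∧ |p - x| < ε := by
  have hreach : ∀ i j, Relation.ReflTransGen E i j →
      ∃ L φ, IsInverseBranch G L (Icc (a i) (b i)) (Icc (a j) (b j)) φ := by
    intro i j h
    induction h with
    | refl => exact ⟨0, id, isInverseBranch_zero _ _⟩
    | tail _ hE ih =>
      obtain ⟨L, φ, hφ⟩ := ih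
      obtain ⟨φ', hφ'⟩ := hedge _ _ hE
      exact ⟨_, _, hφ.comp hφ'⟩
  have hback : ∀ i j, Relation.ReflTransGen E i j → Relation.ReflTransGen E j i := by
    intro i j h
    induction h with
    | refl => exact .refl
    | tail _ hE ih => exact (hsymm _ _ hE).trans ih
  have hcyl : ∀ (L : ℕ) (i : ι), ∀ x ∈ Icc (a i) (b i), ∃ j φ, Relation.ReflTransGen E i j ∧
      IsInverseBranch G L (Icc (a i) (b i)) (Icc (a j) (b j)) φ ∧
      ∀ y ∈ Icc (a j) (b j), |φ y - x| ≤ (1 / 2) ^ L := by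
    intro L
    induction L with
    | zero =>
      intro i x hx
      refine ⟨i, id, .refl, isInverseBranch_zero _ _, fun y hy => ?_⟩
      have := hlen i
      rw [id, pow_zero, abs_le]
      constructor <;> linarith [hx.1, hx.2, hy.1, hy.2]
    | succ L ih =>
      intro i x hx
      obtain ⟨j, φ, hE, hG, hφ, hc⟩ := hpoint i x hx
      obtain ⟨k, φ', hr, hφ', hc'⟩ := ih j (G x) hG
      refine ⟨k, φ ∘ φ', .head hE hr, hφ.comp hφ', fun y hy => ?_⟩
      have h1 := hc _ (hφ'.2.1 hy)
      have h2 := hc' y hy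
      rw [comp_apply, pow_succ]
      linarith
  obtain ⟨L, hL⟩ := exists_pow_lt_of_lt_one hε (by norm_num : (1 / 2 : ℝ) < 1)
  obtain ⟨j, φ, hr, hφ, hc⟩ := hcyl (L + 1) i x hx
  obtain ⟨L', φ', hφ'⟩ := hreach _ _ (hback _ _ hr)
  have hcomp := hφ.comp hφ'
  obtain ⟨p, hp, hfix⟩ := exists_mem_Icc_isFixedPt_of_mapsTo hcomp.1 (hx.1.trans hx.2) hcomp.2.1
  have hfix' : φ (φ' p) = p := hfix
  refine ⟨p, hp, ⟨L' + (L + 1), by omega, ?_⟩, ?_⟩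
  · have h := hcomp.2.2 p hp
    rwa [comp_apply, hfix'] at h
  · have h := hc _ (hφ'.2.1 hp)
    rw [hfix'] at h
    have : (1 / 2 : ℝ) ^ (L + 1) ≤ (1 / 2) ^ L :=
      pow_le_pow_of_le_one (by norm_num) (by norm_num) (Nat.le_succ L)
    linarith

/-- The piecewise affine interpolation of `w 0, …, w N` at the integers `0, …, N`. -/
noncomputable def interp (w : ℕ → ℝ) (N : ℕ) (t : ℝ) : ℝ :=
  w 0 + ∑ k ∈ Finset.range N, (w (k + 1) - w k) * max 0 (min 1 (t - k))

lemma continuous_interp (w : ℕ → ℝ) (N : ℕ) : Continuous (interp w N) := by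
  unfold interp
  fun_prop

lemma interp_of_ge (w : ℕ → ℝ) (N : ℕ) {t : ℝ} (ht : N ≤ t) : interp w N t = w N := by
  have h : ∀ k ∈ Finset.range N,
      (w (k + 1) - w k) * max 0 (min 1 (t - k)) = w (k + 1) - w k := by
    intro k hk
    have : (k : ℝ) + 1 ≤ N := by exact_mod_cast Finset.mem_range.1 hk
    rw [min_eq_left (by linarith), max_eq_right zero_le_one, mul_one]
  rw [interp, Finset.sum_congr rfl h, Finset.sum_range_sub]
  ring

lemma interp_of_mem (w : ℕ → ℝ) {N k : ℕ} (hk : k < N) {t : ℝ} (h0 : k ≤ t) (h1 : t ≤ k + 1) :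
    interp w N t = w k + (t - k) * (w (k + 1) - w k) := by
  induction N with
  | zero => omega
  | succ N ih =>
    have hs : interp w (N + 1) t =
        interp w N t + (w (N + 1) - w N) * max 0 (min 1 (t - N)) := by
      rw [interp, interp, Finset.sum_range_succ, add_assoc]
    rw [hs]
    rcases Nat.lt_succ_iff_lt_or_eq.1 hk with h | rfl
    · have : (k : ℝ) + 1 ≤ N := by exact_mod_cast h
      rw [ih h, max_eq_left (min_le_of_right_le (by linarith))]
      ring
    · rw [interp_of_ge w k h0, min_eq_right (by linarith), max_eq_right (by linarith)]
      ring

/-- A walk with unit steps of prescribed even length, from `s` to `d`, that stays in `[l, u + 1]`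
and traverses every unit block of this interval. -/
lemma exists_covering_walk {l u s d M : ℕ} (hlu : l ≤ u) (hls : l ≤ s) (hsu : s ≤ u + 1)
    (hld : l ≤ d) (hdu : d ≤ u + 1) (hs : Odd s) (hd : Odd d) (hM : Even M)
    (hlen : 3 * (u + 1) ≤ M) :
    ∃ w : ℕ → ℕ, w 0 = s ∧ w M = d ∧
      (∀ t < M, w (t + 1) = w t + 1 ∨ w t = w (t + 1) + 1) ∧
      (∀ t ≤ M, l ≤ w t ∧ w t ≤ u + 1) ∧
      ∀ j, l ≤ j → j ≤ u → ∃ t < M, min (w t) (w (t + 1)) = j := by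
  obtain ⟨s, rfl⟩ := hs
  obtain ⟨d, rfl⟩ := hd
  obtain ⟨m, rfl⟩ := hM
  obtain ⟨R, hR⟩ : ∃ R, R + R + ((2 * s + 1 - l) + (u + 1 - l) + (u + 1 - (2 * d + 1))) = m + m :=
    ⟨(m + m - ((2 * s + 1 - l) + (u + 1 - l) + (u + 1 - (2 * d + 1)))) / 2, by omega⟩
  refine ⟨fun t => if t ≤ 2 * s + 1 - l then 2 * s + 1 - t
    else if t ≤ 2 * s + 1 - l + (R + R) then l + (t - (2 * s + 1 - l)) % 2
    else if t ≤ 2 * s + 1 - l + (R + R) + (u + 1 - l) then l + (t - (2 * s + 1 - l + (R + R)))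
    else u + 1 - (t - (2 * s + 1 - l + (R + R) + (u + 1 - l))), ?_, ?_, ?_, ?_, ?_⟩
  · simp
  · dsimp only
    split_ifs <;> omega
  · intro t ht
    dsimp only
    split_ifs <;> omega
  · intro t ht
    dsimp only
    split_ifs <;> omega
  · intro j hj hj'
    refine ⟨2 * s + 1 - l + (R + R) + (j - l), by omega, ?_⟩
    dsimp only
    split_ifs <;> omega

/-- The `i`-th closed interval of the uniform partition of `[0, 1]` into `n` blocks. -/
def block (n i : ℕ) : Set ℝ := Icc ((i : ℝ) / n) ((i + 1 : ℝ) / n)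

lemma mem_block_iff {n i : ℕ} (hn : 0 < n) {x : ℝ} :
    x ∈ block n i ↔ (i : ℝ) ≤ n * x ∧ n * x ≤ i + 1 := by
  have hn' : (0 : ℝ) < n := by exact_mod_cast hn
  rw [block, mem_Icc, div_le_iff₀ hn', le_div_iff₀ hn', mul_comm x]

lemma exists_nat_between {M : ℕ} (hM : 0 < M) {r : ℝ} (h0 : 0 ≤ r) (h1 : r ≤ M) :
    ∃ t < M, (t : ℝ) ≤ r ∧ r ≤ t + 1 := by
  rcases h1.lt_or_eq with h | h
  · exact ⟨⌊r⌋₊, (Nat.floor_lt h0).2 h, Nat.floor_le h0, (Nat.lt_floor_add_one r).le⟩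
  · obtain ⟨m, rfl⟩ : ∃ m, M = m + 1 := ⟨M - 1, by omega⟩
    refine ⟨m, by omega, ?_, ?_⟩ <;> rw [h] <;> push_cast <;> linarith

lemma exists_mem_block {n : ℕ} (hn : 0 < n) {x : ℝ} (hx : x ∈ Icc (0 : ℝ) 1) :
    ∃ i : Fin n, x ∈ block n i := by
  have hn' : (0 : ℝ) < n := by exact_mod_cast hn
  obtain ⟨t, ht, h⟩ := exists_nat_between hn (mul_nonneg hn'.le hx.1)
    (mul_le_of_le_one_right hn'.le hx.2)
  exact ⟨⟨t, ht⟩, (mem_block_iff hn).2 h⟩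

lemma block_subset_Icc {n : ℕ} (i : Fin n) : block n i ⊆ Icc (0 : ℝ) 1 := by
  intro x hx
  have hn : 0 < n := i.pos
  have hn' : (0 : ℝ) < n := by exact_mod_cast hn
  rw [mem_block_iff hn] at hx
  have hi : ((i : ℕ) : ℝ) + 1 ≤ n := by exact_mod_cast i.2
  have h0 : (0 : ℝ) ≤ (i : ℕ) := Nat.cast_nonneg _
  constructor
  · by_contra! h
    nlinarith [hx.1]
  · by_contra! h
    nlinarith [hx.2]

/-- A transition relation on the blocks, given by intervals and with symmetric reachability, is
realised by a map with dense periodic points, with prescribed odd values at the partition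
points. -/
theorem exists_mem_CP_of_transitions {n : ℕ} (hn : 0 < n) {E : Fin n → Fin n → Prop}
    {l u : Fin n → ℕ} (hlu : ∀ i, l i ≤ u i) (hu : ∀ i, u i < n)
    (hE : ∀ i j, E i j ↔ l i ≤ j ∧ (j : ℕ) ≤ u i)
    (hsymm : ∀ i j, E i j → Relation.ReflTransGen E j i) {v : ℕ → ℕ} (hodd : ∀ i, Odd (v i))
    (hl : ∀ i : Fin n, l i ≤ v i ∧ v i ≤ u i) (hr : ∀ i : Fin n, l i ≤ v (i + 1) ∧ v (i + 1) ≤ u i) :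
    ∃ g ∈ CP, (∀ i ≤ n, ∀ x : unitI, (x : ℝ) = i / n → (g x : ℝ) = v i / n) ∧
      ∀ (i : Fin n) (x : unitI), (x : ℝ) ∈ block n i → ∃ j, E i j ∧ (g x : ℝ) ∈ block n j := by
  have hn' : (0 : ℝ) < n := by exact_mod_cast hn
  have hne : (n : ℝ) ≠ 0 := hn'.ne'
  obtain ⟨M, hMdef⟩ : ∃ M, M = 4 * n := ⟨_, rfl⟩
  have hM : 0 < M := by omega
  have hM2 : (2 : ℝ) ≤ M := by exact_mod_cast (by omega : 2 ≤ M)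
  have hMe : (M : ℝ) ≠ 0 := by positivity
  choose W hW0 hWM hstep hrange hcover using fun i : Fin n =>
    exists_covering_walk (hlu i) (hl i).1 ((hl i).2.trans (Nat.le_succ _)) (hr i).1
      ((hr i).2.trans (Nat.le_succ _)) (hodd i) (hodd (i + 1))
      (show Even M from ⟨2 * n, by omega⟩) (by have := hu i; omega)
  let w : ℕ → ℝ := fun k => if h : k / M < n then (W ⟨k / M, h⟩ (k % M) : ℝ) else v (k / M)
  have hw0 : ∀ i ≤ n, w (i * M) = v i := by
    intro i hi
    have h1 : i * M / M = i := Nat.mul_div_cancel _ hM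
    have h2 : i * M % M = 0 := Nat.mul_mod_left _ _
    simp only [w, h1, h2]
    split_ifs with h
    · rw [hW0]
    · rfl
  have hw : ∀ (i : Fin n) (t : ℕ), t ≤ M → w (i * M + t) = W i t := by
    intro i t ht
    rcases ht.lt_or_eq with h | rfl
    · have h1 : (i * M + t) / M = i := by
        rw [mul_comm, Nat.mul_add_div hM, Nat.div_eq_of_lt h, add_zero]
      have h2 : (i * M + t) % M = t := by
        rw [mul_comm, Nat.mul_add_mod, Nat.mod_eq_of_lt h]
      simp only [w, h1, h2, i.2, dite_true]
    · have := hw0 (i + 1) i.2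
      rw [hWM, ← this]
      congr 1
      ring
  let G : ℝ → ℝ := fun x => interp w (n * M) (n * M * x) / n
  have hGc : Continuous G := by
    have := continuous_interp w (n * M)
    fun_prop
  have hG : ∀ (i : Fin n) (t : ℕ), t < M → ∀ x : ℝ, (i * M + t : ℝ) ≤ n * M * x →
      n * M * x ≤ i * M + t + 1 →
      G x = (W i t + (n * M * x - (i * M + t)) * (W i (t + 1) - W i t)) / n := by
    intro i t ht x h0 h1
    have hk : i * M + t < n * M := by
      have : (i + 1 : ℕ) * M ≤ n * M := Nat.mul_le_mul_right _ i.2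
      rw [add_mul] at this
      omega
    have := interp_of_mem w hk (t := n * M * x) (by push_cast; exact h0) (by push_cast; exact h1)
    simp only [G, this]
    rw [hw i t ht.le, add_assoc (i * M : ℕ), hw i (t + 1) ht]
    push_cast
    rfl
  have hbranch : ∀ (i : Fin n) (t : ℕ), t < M → ∀ j : Fin n, min (W i t) (W i (t + 1)) = j →
      ∃ φ, IsInverseBranch G 1 (block n i) (block n j) φ ∧
        ∀ x : ℝ, (i * M + t : ℝ) ≤ n * M * x → n * M * x ≤ i * M + t + 1 →
          G x ∈ block n j ∧ ∀ y, |φ y - x| ≤ |y - G x| / 2 := by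
    intro i t ht j hj
    obtain ⟨e, he, he1, hlo⟩ : ∃ e : ℝ, (W i (t + 1) : ℝ) - W i t = e ∧ e * e = 1 ∧
        ((W i t : ℝ) = j ∧ e = 1 ∨ (W i t : ℝ) = j + 1 ∧ e = -1) := by
      rcases hstep i t ht with h | h
      · have : W i t = j := by omega
        refine ⟨1, ?_, by norm_num, Or.inl ⟨by rw [this], rfl⟩⟩
        rw [h]; push_cast; ring
      · have : W i t = j + 1 := by omega
        refine ⟨-1, ?_, by norm_num, Or.inr ⟨by rw [this]; push_cast; rfl, rfl⟩⟩
        rw [h]; push_cast; ring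
    have ht' : (t : ℝ) + 1 ≤ M := by exact_mod_cast ht
    have ht0 : (0 : ℝ) ≤ t := Nat.cast_nonneg t
    have hφ : ∀ y, n * M * ((i * M + t + (n * y - W i t) * e) / (n * M)) =
        (i * M + t + (n * y - W i t) * e : ℝ) := fun y => by field_simp
    have hpiece : ∀ y ∈ block n j, 0 ≤ (n * y - W i t) * e ∧ (n * y - W i t) * e ≤ 1 := by
      intro y hy
      rw [mem_block_iff hn] at hy
      rcases hlo with ⟨h, rfl⟩ | ⟨h, rfl⟩ <;> rw [h] <;> constructor <;> linarith [hy.1, hy.2]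
    refine ⟨fun y => (i * M + t + (n * y - W i t) * e) / (n * M), ⟨by fun_prop, ?_, ?_⟩, ?_⟩
    · intro y hy
      obtain ⟨h0, h1⟩ := hpiece y hy
      rw [mem_block_iff hn]
      have hMpos : (0 : ℝ) < M := by linarith
      have h2 : (n : ℝ) * ((i * M + t + (n * y - W i t) * e) / (n * M)) =
          (i * M + t + (n * y - W i t) * e) / M := by field_simp
      rw [h2, le_div_iff₀ hMpos, div_le_iff₀ hMpos]
      constructor <;> nlinarith
    · intro y hy
      obtain ⟨h0, h1⟩ := hpiece y hy
      rw [iterate_one, hG i t ht _ (by rw [hφ]; linarith) (by rw [hφ]; linarith), hφ, he,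
        div_eq_iff hne]
      linear_combination (n * y - W i t) * he1
    · intro x h0 h1
      have hGx := hG i t ht x h0 h1
      rw [he, eq_div_iff hne] at hGx
      refine ⟨?_, fun y => ?_⟩
      · rw [mem_block_iff hn]
        rcases hlo with ⟨h, rfl⟩ | ⟨h, rfl⟩ <;> rw [h] at hGx <;> constructor <;> linarith
      · have : (i * M + t + (n * y - W i t) * e) / (n * M) - x = e * (y - G x) / M := by
          field_simp
          linear_combination e * hGx + (n * M * x - (i * M + t)) * he1
        have habs : |e| = 1 := by
          rcases hlo with ⟨_, rfl⟩ | ⟨_, rfl⟩ <;> simp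
        rw [this, abs_div, abs_mul, habs, one_mul, abs_of_pos (by linarith : (0 : ℝ) < M)]
        exact div_le_div_of_nonneg_left (abs_nonneg _) (by norm_num) hM2
  have hpoint : ∀ (i : Fin n), ∀ x ∈ block n i, ∃ j φ, E i j ∧ G x ∈ block n j ∧
      IsInverseBranch G 1 (block n i) (block n j) φ ∧
      ∀ y ∈ block n j, |φ y - x| ≤ |y - G x| / 2 := by
    intro i x hx
    rw [mem_block_iff hn] at hx
    obtain ⟨t, ht, h0, h1⟩ := exists_nat_between hM (r := n * M * x - i * M)
      (by nlinarith [hx.1]) (by nlinarith [hx.2])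
    have hr0 := hrange i t ht.le
    have hr1 := hrange i (t + 1) ht
    have hui := hu i
    have hs := hstep i t ht
    obtain ⟨φ, hφ, hφ'⟩ := hbranch i t ht ⟨min (W i t) (W i (t + 1)), by omega⟩ rfl
    obtain ⟨h2, h3⟩ := hφ' x (by linarith) (by linarith)
    refine ⟨_, φ, (hE _ _).2 ?_, h2, hφ, fun y _ => h3 y⟩
    constructor <;> dsimp only <;> omega
  have hedge : ∀ i j, E i j → ∃ φ, IsInverseBranch G 1 (block n i) (block n j) φ := by
    intro i j hij
    obtain ⟨t, ht, h⟩ := hcover i j ((hE i j).1 hij).1 ((hE i j).1 hij).2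
    obtain ⟨φ, hφ, -⟩ := hbranch i t ht j h
    exact ⟨φ, hφ⟩
  have hmaps : ∀ x ∈ Icc (0 : ℝ) 1, G x ∈ Icc (0 : ℝ) 1 := by
    intro x hx
    obtain ⟨i, hi⟩ := exists_mem_block hn hx
    obtain ⟨j, -, -, hj, -⟩ := hpoint i x hi
    exact block_subset_Icc j hj
  let g : C(unitI, unitI) := ⟨fun x => ⟨G x, hmaps x x.2⟩, by fun_prop⟩
  have hsemi : Semiconj (Subtype.val : unitI → ℝ) g G := fun x => rfl
  have hdense : Dense (periodicPts g) := by
    rw [Metric.dense_iff]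
    intro x r hr
    obtain ⟨i, hi⟩ := exists_mem_block hn x.2
    have hlen : ∀ i : Fin n, ((i : ℕ) + 1 : ℝ) / n ≤ (i : ℕ) / n + 1 := by
      intro i
      rw [add_div]
      have : (1 : ℝ) / n ≤ 1 := by
        rw [div_le_one hn']
        exact_mod_cast hn
      linarith
    obtain ⟨p, hp, ⟨k, hk, hper⟩, hpx⟩ :=
      exists_periodic_near_of_markov hlen hpoint hedge hsymm hi hr
    refine ⟨⟨p, block_subset_Icc i hp⟩, ?_, k, hk, ?_⟩
    · rw [mem_ball, Subtype.dist_eq, Real.dist_eq]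
      exact hpx
    · apply Subtype.ext
      rw [hsemi.iterate_right k]
      exact hper
  have hsurj : Surjective g := by
    have hcl : IsClosed (range g) := (isCompact_range g.continuous).isClosed
    have hsub : periodicPts g ⊆ range g := by
      rintro p ⟨k, hk, hper⟩
      obtain ⟨m, rfl⟩ : ∃ m, k = m + 1 := ⟨k - 1, by omega⟩
      exact ⟨g^[m] p, by rw [← iterate_succ_apply' g]; exact hper⟩
    rw [← range_eq_univ, ← hcl.closure_eq]
    exact (hdense.mono hsub).closure_eq
  refine ⟨g, ⟨hsurj, hdense⟩, ?_, ?_⟩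
  · intro i hi x hx
    change G x = _
    have hx' : (n : ℝ) * M * x = (i * M : ℕ) := by
      rw [hx]
      push_cast
      field_simp
    simp only [G, hx']
    rw [← hw0 i hi]
    congr 1
    rcases hi.lt_or_eq with h | h
    · rw [interp_of_mem w (Nat.mul_lt_mul_of_pos_right h hM) le_rfl (by linarith)]
      ring
    · rw [h]
      exact interp_of_ge w _ le_rfl
  · intro i x hx
    obtain ⟨j, -, h, h', -⟩ := hpoint i x hx
    exact ⟨j, h, h'⟩

lemma exists_interval_of_ordConnected {n : ℕ} {P : Fin n → Prop} (hne : ∃ j, P j)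
    (hconv : ∀ a b c, P a → P c → a ≤ b → b ≤ c → P b) :
    ∃ l u : ℕ, l ≤ u ∧ u < n ∧ ∀ j : Fin n, P j ↔ l ≤ j ∧ (j : ℕ) ≤ u := by
  classical
  have hS : (Finset.univ.filter P).Nonempty := by
    obtain ⟨j, hj⟩ := hne
    exact ⟨j, by simpa using hj⟩
  have hmin : P ((Finset.univ.filter P).min' hS) := by simpa using Finset.min'_mem _ hS
  have hmax : P ((Finset.univ.filter P).max' hS) := by simpa using Finset.max'_mem _ hS
  refine ⟨(Finset.univ.filter P).min' hS, (Finset.univ.filter P).max' hS,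
    Finset.min'_le _ _ (Finset.max'_mem _ hS), Fin.is_lt _, fun j => ⟨fun hj => ?_, fun hj => ?_⟩⟩
  · have hj' : j ∈ Finset.univ.filter P := by simpa using hj
    exact ⟨Finset.min'_le _ _ hj', Finset.le_max' _ _ hj'⟩
  · exact hconv _ _ _ hmin hmax hj.1 hj.2

/-- The block transitions of `f` along periodic points, with tolerance `K` in the target. -/
def periodicTransition (f : unitI → unitI) (n K : ℕ) (i j : Fin n) : Prop :=
  ∃ b : Fin n, ∃ y ∈ periodicPts f, (y : ℝ) ∈ block n i ∧ (f y : ℝ) ∈ block n b ∧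
    (b : ℕ) ≤ j + K ∧ (j : ℕ) ≤ b + K

lemma periodicTransition_of_orbit {f : unitI → unitI} {n K : ℕ} (t : ℕ) :
    ∀ {y : unitI} {i k : Fin n}, y ∈ periodicPts f → (y : ℝ) ∈ block n i →
      (f^[t + 1] y : ℝ) ∈ block n k → Relation.ReflTransGen (periodicTransition f n K) i k := by
  induction t with
  | zero =>
    intro y i k hy hi hk
    exact .single ⟨k, y, hy, hi, hk, by omega, by omega⟩
  | succ t ih =>
    intro y i k hy hi hk
    obtain ⟨j, hj⟩ := exists_mem_block i.pos (f y).2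
    have hfy : f y ∈ periodicPts f := (bijOn_periodicPts f).mapsTo hy
    exact .head ⟨j, y, hy, hi, hj, by omega, by omega⟩ (ih hfy hj hk)

lemma exists_periodic_mem_block {f : unitI → unitI} (hf : Dense (periodicPts f)) {n : ℕ}
    (i : Fin n) : ∃ y ∈ periodicPts f, (y : ℝ) ∈ block n i := by
  have hn : 0 < n := i.pos
  have hn' : (0 : ℝ) < n := by exact_mod_cast hn
  have hi : ((i : ℕ) : ℝ) + 1 ≤ n := by exact_mod_cast i.2
  have hi0 : (0 : ℝ) ≤ (i : ℕ) := Nat.cast_nonneg _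
  have hopen : IsOpen {x : unitI | ((i : ℕ) : ℝ) < n * x ∧ n * (x : ℝ) < (i : ℕ) + 1} :=
    IsOpen.and (isOpen_lt (by fun_prop) (by fun_prop)) (isOpen_lt (by fun_prop) (by fun_prop))
  have hmid : (n : ℝ) * (((i : ℕ) + 1 / 2) / n) = (i : ℕ) + 1 / 2 := by field_simp
  obtain ⟨y, hy, hyp⟩ := hf.exists_mem_open hopen
    ⟨⟨((i : ℕ) + 1 / 2) / n, by positivity, by rw [div_le_one hn']; linarith⟩,
      by rw [mem_ofPred_eq, hmid]; constructor <;> linarith⟩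
  exact ⟨y, hy, (mem_block_iff hn).2 ⟨hyp.1.le, hyp.2.le⟩⟩

lemma exists_pos_iterate_comp_eq {α : Type*} {f : α → α} {y : α} (hy : y ∈ periodicPts f) :
    ∃ t, f^[t + 1] (f y) = y := by
  obtain ⟨k, hk, hper⟩ := hy
  obtain ⟨m, rfl⟩ : ∃ m, k = m + 1 := ⟨k - 1, by omega⟩
  refine ⟨m + m, ?_⟩
  rw [← iterate_succ_apply, show (m + m + 1).succ = (m + 1) + (m + 1) by omega]
  exact hper.add hper

lemma periodicTransition_symm {f : unitI → unitI} (hf : Dense (periodicPts f)) {n K : ℕ}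
    {i j : Fin n} (h : periodicTransition f n K i j) :
    Relation.ReflTransGen (periodicTransition f n K) j i := by
  obtain ⟨b, y, hy, hi, hb, hbj, hjb⟩ := h
  obtain ⟨z, hz, hzj⟩ := exists_periodic_mem_block hf j
  obtain ⟨w, hw, rfl⟩ := (bijOn_periodicPts f).surjOn hz
  obtain ⟨k, hk⟩ := exists_mem_block i.pos w.2
  obtain ⟨t, ht⟩ := exists_pos_iterate_comp_eq hw
  obtain ⟨t', ht'⟩ := exists_pos_iterate_comp_eq hy
  have h1 : Relation.ReflTransGen (periodicTransition f n K) j k :=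
    periodicTransition_of_orbit t hz hzj (by rwa [ht])
  have h2 : periodicTransition f n K k b := ⟨j, w, hw, hk, hzj, hjb, hbj⟩
  have h3 : Relation.ReflTransGen (periodicTransition f n K) b i :=
    periodicTransition_of_orbit t' ((bijOn_periodicPts f).mapsTo hy) hb (by rwa [ht'])
  exact (h1.tail h2).trans h3

lemma left_mem_block {n : ℕ} (i : Fin n) : ((i : ℕ) : ℝ) / n ∈ block n i := by
  have hn' : (0 : ℝ) < n := by exact_mod_cast i.pos
  exact ⟨le_rfl, div_le_div_of_nonneg_right (by linarith) hn'.le⟩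

lemma right_mem_block {n : ℕ} (i : Fin n) : ((i : ℕ) + 1 : ℝ) / n ∈ block n i := by
  have hn' : (0 : ℝ) < n := by exact_mod_cast i.pos
  exact ⟨div_le_div_of_nonneg_right (by linarith) hn'.le, le_rfl⟩

/-- A map with dense periodic points can be approximated in `CP` with prescribed odd values at the
points of a fine uniform partition. -/
theorem exists_mem_CP_approx {f : C(unitI, unitI)} (hf : f ∈ CP) {η : ℝ} (hη : 0 < η) :
    ∃ N : ℕ, ∀ n ≥ N, ∀ v : ℕ → ℕ, (∀ i, Odd (v i)) → (∀ i, v i < n) →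
      (∀ i ≤ n, ∀ x : unitI, (x : ℝ) = i / n → |(v i : ℝ) - n * f x| ≤ n * η) →
      ∃ g ∈ CP, (∀ i ≤ n, ∀ x : unitI, (x : ℝ) = i / n → (g x : ℝ) = v i / n) ∧
        dist g f ≤ 4 * η := by
  obtain ⟨δ, hδ, hfδ⟩ := Metric.uniformContinuous_iff.1
    (CompactSpace.uniformContinuous_of_continuous f.continuous) η hη
  obtain ⟨N₁, hN₁⟩ := exists_nat_gt (1 / δ)
  obtain ⟨N₂, hN₂⟩ := exists_nat_gt (4 / η)
  refine ⟨max N₁ N₂ + 1, fun n hnN v hodd hvn hv => ?_⟩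
  have hn : 0 < n := by omega
  have hn' : (0 : ℝ) < n := by exact_mod_cast hn
  have hnδ : 1 < n * δ := by
    have : (N₁ : ℝ) ≤ n := by exact_mod_cast (by omega : N₁ ≤ n)
    exact (div_lt_iff₀ hδ).1 (hN₁.trans_le this)
  have hnη : 4 < n * η := by
    have : (N₂ : ℝ) ≤ n := by exact_mod_cast (by omega : N₂ ≤ n)
    exact (div_lt_iff₀ hη).1 (hN₂.trans_le this)
  have hosc : ∀ (i : Fin n) (x y : unitI), (x : ℝ) ∈ block n i → (y : ℝ) ∈ block n i →
      |n * (f x : ℝ) - n * f y| ≤ n * η := by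
    intro i x y hx hy
    rw [mem_block_iff hn] at hx hy
    have hxy : dist x y < δ := by
      rw [Subtype.dist_eq, Real.dist_eq, abs_lt]
      constructor <;> by_contra! h <;> nlinarith [hx.1, hx.2, hy.1, hy.2]
    have h := (hfδ hxy).le
    rw [Subtype.dist_eq, Real.dist_eq] at h
    rw [← mul_sub, abs_mul, abs_of_pos hn']
    exact mul_le_mul_of_nonneg_left h hn'.le
  obtain ⟨K, hK, hK'⟩ : ∃ K : ℕ, 2 * (n * η) + 1 ≤ (K : ℝ) ∧ (K : ℝ) ≤ 2 * (n * η) + 2 := by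
    refine ⟨⌈2 * (n * η) + 1⌉₊, Nat.le_ceil _, ?_⟩
    have := Nat.ceil_lt_add_one (a := 2 * (n * η) + 1) (by positivity)
    linarith
  have hcast : ∀ a b : ℕ, (a : ℝ) ≤ b + K → a ≤ b + K := fun a b h => by exact_mod_cast h
  have hvE : ∀ (i : Fin n) (p : ℕ), p ≤ n → ((p : ℝ) / n) ∈ block n i →
      periodicTransition f n K i ⟨v p, hvn p⟩ := by
    intro i p hp hpi
    obtain ⟨y, hy, hyi⟩ := exists_periodic_mem_block hf.2 i
    obtain ⟨b, hb⟩ := exists_mem_block hn (f y).2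
    have h1 := abs_le.1 (hv p hp ⟨_, block_subset_Icc i hpi⟩ rfl)
    have h2 := abs_le.1 (hosc i ⟨_, block_subset_Icc i hpi⟩ y hpi hyi)
    have h3 := (mem_block_iff hn).1 hb
    refine ⟨b, y, hy, hyi, hb, hcast _ _ ?_, hcast _ _ ?_⟩ <;> dsimp only <;>
      linarith [h1.1, h1.2, h2.1, h2.2, h3.1, h3.2]
  have hconv : ∀ i a b c : Fin n, periodicTransition f n K i a → periodicTransition f n K i c →
      a ≤ b → b ≤ c → periodicTransition f n K i b := by
    rintro i a b c ⟨b₁, y₁, hy₁, hi₁, hb₁, h₁, h₁'⟩ ⟨b₂, y₂, hy₂, hi₂, hb₂, h₂, h₂'⟩ hab hbc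
    have hd := abs_le.1 (hosc i y₁ y₂ hi₁ hi₂)
    have h3 := (mem_block_iff hn).1 hb₁
    have h4 := (mem_block_iff hn).1 hb₂
    have hlt : (b₂ : ℕ) ≤ b₁ + K := hcast _ _ (by linarith [hd.1, hd.2, h3.1, h3.2, h4.1, h4.2])
    have hab' : (a : ℕ) ≤ b := hab
    have hbc' : (b : ℕ) ≤ c := hbc
    by_cases h : (b : ℕ) ≤ b₁ + K
    · exact ⟨b₁, y₁, hy₁, hi₁, hb₁, by omega, h⟩
    · exact ⟨b₂, y₂, hy₂, hi₂, hb₂, by omega, by omega⟩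
  choose l u hlu hu hE using fun i : Fin n => exists_interval_of_ordConnected
    ⟨_, hvE i i i.2.le (left_mem_block i)⟩ (hconv i)
  obtain ⟨g, hg, hgv, hgE⟩ := exists_mem_CP_of_transitions hn hlu hu hE
    (fun i j h => periodicTransition_symm hf.2 h) hodd
    (fun i => (hE i _).1 (hvE i i i.2.le (left_mem_block i)))
    (fun i => (hE i _).1 (hvE i (i + 1) i.2 (by push_cast; exact right_mem_block i)))
  refine ⟨g, hg, hgv, ?_⟩
  rw [ContinuousMap.dist_le (by positivity)]
  intro x
  obtain ⟨i, hi⟩ := exists_mem_block hn x.2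
  obtain ⟨j, ⟨b, y, hy, hyi, hb, hbj, hjb⟩, hgj⟩ := hgE i x hi
  have hd := abs_le.1 (hosc i x y hi hyi)
  have h1 := (mem_block_iff hn).1 hb
  have h2 := (mem_block_iff hn).1 hgj
  have h3 : ((b : ℕ) : ℝ) ≤ (j : ℕ) + K := by exact_mod_cast hbj
  have h4 : ((j : ℕ) : ℝ) ≤ (b : ℕ) + K := by exact_mod_cast hjb
  rw [Subtype.dist_eq, Real.dist_eq, abs_le]
  constructor <;> refine le_of_mul_le_mul_left ?_ hn' <;>
    linarith [hd.1, hd.2, h1.1, h1.2, h2.1, h2.2]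

lemma iterate_eq_of_grid {g : unitI → unitI} {n : ℕ} {v : ℕ → ℕ} (hv : ∀ i, v i < n)
    (hg : ∀ i ≤ n, ∀ x : unitI, (x : ℝ) = i / n → (g x : ℝ) = v i / n) (a : ℕ) :
    ∀ {s : ℕ} {x : unitI}, s ≤ n → (x : ℝ) = s / n → (g^[a] x : ℝ) = (v^[a] s : ℕ) / n := by
  induction a with
  | zero => intro s x _ hx; exact hx
  | succ a ih =>
    intro s x hs hx
    exact ih (hv s).le (hg s hs x hx)

lemma exists_odd_near {n : ℕ} (hn : 8 ≤ n) {r : ℝ} (h0 : 0 ≤ r) (h1 : r ≤ n) :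
    ∃ c : ℕ, Odd c ∧ 3 ≤ c ∧ c + 3 ≤ n ∧ |(c : ℝ) - r| ≤ 5 := by
  have hfl := Nat.floor_le h0
  have hfl' := Nat.lt_floor_add_one r
  have hq : ⌊r⌋₊ ≤ n := Nat.floor_le_of_le h1
  have hclose : ∀ c : ℕ, c ≤ ⌊r⌋₊ + 4 → ⌊r⌋₊ ≤ c + 4 → |(c : ℝ) - r| ≤ 5 := by
    intro c hc hc'
    have h2 : (c : ℝ) ≤ ⌊r⌋₊ + 4 := by exact_mod_cast hc
    have h3 : (⌊r⌋₊ : ℝ) ≤ c + 4 := by exact_mod_cast hc'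
    rw [abs_le]
    constructor <;> linarith
  by_cases hlow : ⌊r⌋₊ < 3
  · exact ⟨3, by decide, le_rfl, by omega, hclose _ (by omega) (by omega)⟩
  by_cases hhigh : n < ⌊r⌋₊ + 4
  · exact ⟨2 * ((n - 4) / 2) + 1, ⟨_, rfl⟩, by omega, by omega, hclose _ (by omega) (by omega)⟩
  · exact ⟨2 * (⌊r⌋₊ / 2) + 1, ⟨_, rfl⟩, by omega, by omega, hclose _ (by omega) (by omega)⟩

/-- Arbitrarily close to every map in `CP` there are maps in `CP` for which the same two iterates
of the endpoint `0` are ordered in opposite ways. -/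
theorem exists_mem_CP_iterates_both_orders {f : C(unitI, unitI)} (hf : f ∈ CP) {ε : ℝ}
    (hε : 0 < ε) :
    ∃ m k : ℕ, (∃ g ∈ CP, dist g f < ε ∧ g^[m] 0 < g^[k] 0) ∧
      ∃ g ∈ CP, dist g f < ε ∧ g^[k] 0 < g^[m] 0 := by
  have hη : 0 < ε / 5 := by positivity
  obtain ⟨N, hN⟩ := exists_mem_CP_approx hf hη
  obtain ⟨N', hN'⟩ := exists_nat_gt (7 / (ε / 5))
  obtain ⟨n, hnN, hn8, hnN'⟩ : ∃ n, N ≤ n ∧ 8 ≤ n ∧ N' ≤ n := ⟨N + N' + 8, by omega⟩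
  have hn' : (0 : ℝ) < n := by exact_mod_cast (by omega : 0 < n)
  have hnη : 7 < n * (ε / 5) := by
    have : (N' : ℝ) ≤ n := by exact_mod_cast hnN'
    exact (div_lt_iff₀ hη).1 (hN'.trans_le this)
  have hv : ∀ i : ℕ, ∃ c : ℕ, Odd c ∧ 3 ≤ c ∧ c + 3 ≤ n ∧
      ∀ x : unitI, (x : ℝ) = i / n → |(c : ℝ) - n * f x| ≤ 5 := by
    intro i
    by_cases h : ∃ x : unitI, (x : ℝ) = i / n
    · obtain ⟨x, hx⟩ := h
      obtain ⟨c, h1, h2, h3, h4⟩ := exists_odd_near hn8 (mul_nonneg hn'.le (f x).2.1)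
        (mul_le_of_le_one_right hn'.le (f x).2.2)
      refine ⟨c, h1, h2, h3, fun y hy => ?_⟩
      rwa [show y = x from Subtype.ext (hy.trans hx.symm)]
    · exact ⟨3, by decide, le_rfl, by omega, fun x hx => (h ⟨x, hx⟩).elim⟩
  choose v hodd hv3 hvn hvf using hv
  have hrep : ∃ k, ∃ m < k, v^[m] 0 = v^[k] 0 := by
    have hlt : ∀ a, v^[a] 0 < n + 1 := by
      intro a
      cases a with
      | zero => simp
      | succ a =>
        rw [iterate_succ_apply']
        have := hvn (v^[a] 0)
        omega
    obtain ⟨a, b, hab, h⟩ := Finite.exists_ne_map_eq_of_infinite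
      (fun a : ℕ => (⟨v^[a] 0, hlt a⟩ : Fin (n + 1)))
    have h' : v^[a] 0 = v^[b] 0 := congrArg Fin.val h
    rcases hab.lt_or_gt with hlt | hlt
    · exact ⟨b, a, hlt, h'⟩
    · exact ⟨a, b, hlt, h'.symm⟩
  classical
  obtain ⟨k, ⟨m, hmk, hmeq⟩, hmin⟩ : ∃ k, (∃ m < k, v^[m] 0 = v^[k] 0) ∧
      ∀ k' < k, ¬ ∃ m < k', v^[m] 0 = v^[k'] 0 :=
    ⟨Nat.find hrep, Nat.find_spec hrep, fun _ h => Nat.find_min hrep h⟩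
  obtain ⟨k, rfl⟩ : ∃ k', k = k' + 1 := ⟨k - 1, by omega⟩
  obtain ⟨q, hq⟩ : ∃ q, v^[k] 0 = q := ⟨_, rfl⟩
  have hm : v^[m] 0 = v q := by rw [hmeq, iterate_succ_apply', hq]
  have key : ∀ c : ℕ, Odd c → c < n → c ≤ v q + 2 → v q ≤ c + 2 → ∃ g ∈ CP, dist g f < ε ∧
      (g^[m] 0 : ℝ) = v q / n ∧ (g^[k + 1] 0 : ℝ) = c / n := by
    intro c hc hcn hc1 hc2
    have hv' : ∀ i, update v q c i < n := by
      intro i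
      by_cases h : i = q
      · rw [h, update_self]; exact hcn
      · rw [update_of_ne h]; have := hvn i; omega
    obtain ⟨g, hg, hgv, hgf⟩ := hN n hnN (update v q c) (fun i => by
        by_cases h : i = q
        · rw [h, update_self]; exact hc
        · rw [update_of_ne h]; exact hodd i) hv' (fun i _ x hx => by
        have h5 := abs_le.1 (hvf i x hx)
        have h1 : (c : ℝ) ≤ v q + 2 := by exact_mod_cast hc1
        have h2 : (v q : ℝ) ≤ c + 2 := by exact_mod_cast hc2
        by_cases h : i = q
        · subst h
          rw [update_self, abs_le]
          constructor <;> linarith [h5.1, h5.2]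
        · rw [update_of_ne h, abs_le]
          constructor <;> linarith [h5.1, h5.2])
    have hiter : ∀ a ≤ k, (update v q c)^[a] 0 = v^[a] 0 := by
      intro a
      induction a with
      | zero => simp
      | succ a ih =>
        intro ha
        rw [iterate_succ_apply', iterate_succ_apply', ih (by omega), update_of_ne]
        intro h
        exact hmin k (by omega) ⟨a, by omega, h.trans hq.symm⟩
    have hgrid := fun a => iterate_eq_of_grid hv' hgv a (s := 0) (x := 0) (Nat.zero_le n) (by simp)
    refine ⟨g, hg, by linarith, ?_, ?_⟩
    · rw [hgrid, hiter m (by omega), hm]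
    · rw [hgrid, iterate_succ_apply', hiter k le_rfl, hq, update_self]
  have hq3 := hv3 q
  have hqn := hvn q
  have hqo := hodd q
  refine ⟨m, k + 1, ?_, ?_⟩
  · obtain ⟨g, hg, hgf, h1, h2⟩ := key (v q + 2) (by grind) (by omega) le_rfl (by omega)
    refine ⟨g, hg, hgf, ?_⟩
    rw [← Subtype.coe_lt_coe, h1, h2]
    gcongr
    omega
  · obtain ⟨g, hg, hgf, h1, h2⟩ := key (v q - 2) (by grind) (by omega) (by omega) (by omega)
    refine ⟨g, hg, hgf, ?_⟩
    rw [← Subtype.coe_lt_coe, h1, h2]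
    gcongr
    omega

lemma exists_mem_CP_endpoints_descend :
    ∃ g ∈ CP, g (g 0) < g 0 ∧ g (g 1) < g 1 := by
  have hid : ContinuousMap.id unitI ∈ CP := by
    refine ⟨surjective_id, ?_⟩
    convert dense_univ
    exact eq_univ_of_forall fun x => ⟨1, one_pos, rfl⟩
  obtain ⟨N, hN⟩ := exists_mem_CP_approx hid one_pos
  obtain ⟨n, hnN, hn⟩ : ∃ n, N ≤ n ∧ 4 ≤ n := ⟨N + 4, by omega⟩
  have hn' : (0 : ℝ) < n := by exact_mod_cast (by omega : 0 < n)
  have hvn : ∀ i : ℕ, (if i = 3 then 1 else 3) < n := fun i => by split_ifs <;> omega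
  obtain ⟨g, hg, hgv, -⟩ := hN n hnN (fun i => if i = 3 then 1 else 3)
    (fun i => by split_ifs <;> decide) hvn (fun i hi x hx => by
      have h1 : (((if i = 3 then 1 else 3 : ℕ)) : ℝ) ≤ n := by exact_mod_cast (hvn i).le
      have h2 : (0 : ℝ) ≤ ((if i = 3 then 1 else 3 : ℕ) : ℝ) := Nat.cast_nonneg _
      have h3 : (n : ℝ) * x ≤ n := mul_le_of_le_one_right hn'.le x.2.2
      have h4 : 0 ≤ (n : ℝ) * x := mul_nonneg hn'.le x.2.1
      rw [ContinuousMap.id_apply, abs_le]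
      constructor <;> linarith)
  have hgrid := fun a s x => iterate_eq_of_grid hvn hgv a (s := s) (x := x)
  have hlt : (1 : ℝ) / n < 3 / n := by gcongr; norm_num
  refine ⟨g, hg, ?_, ?_⟩ <;> rw [← Subtype.coe_lt_coe]
  · have h1 := hgrid 1 0 0 (Nat.zero_le n) (by simp)
    have h2 := hgrid 2 0 0 (Nat.zero_le n) (by simp)
    simp at h1 h2
    rw [h1, h2, ← one_div]
    exact hlt
  · have hne : n ≠ 3 := by omega
    have h1 := hgrid 1 n 1 le_rfl (by rw [div_self hn'.ne']; rfl)
    have h2 := hgrid 2 n 1 le_rfl (by rw [div_self hn'.ne']; rfl)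
    simp [hne] at h1 h2
    rw [h1, h2, ← one_div]
    exact hlt

lemma continuous_iterate_eval (m : ℕ) (x : unitI) :
    Continuous fun f : C(unitI, unitI) => f^[m] x := by
  induction m with
  | zero => exact continuous_const
  | succ m ih =>
    simp only [iterate_succ_apply']
    exact continuous_id.eval ih

lemma ConjugateTo.refl (f : C(unitI, unitI)) : ConjugateTo f f :=
  ⟨Homeomorph.refl _, fun _ => rfl⟩

lemma ConjugateTo.symm {f g : C(unitI, unitI)} (h : ConjugateTo f g) : ConjugateTo g f := by
  obtain ⟨ψ, hψ⟩ := h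
  exact ⟨ψ.symm, fun x => by simp [hψ]⟩

lemma ConjugateTo.trans {f g h : C(unitI, unitI)} (hfg : ConjugateTo f g)
    (hgh : ConjugateTo g h) : ConjugateTo f h := by
  obtain ⟨ψ, hψ⟩ := hfg
  obtain ⟨χ, hχ⟩ := hgh
  exact ⟨χ.trans ψ, fun x => by simp [hψ, hχ]⟩

/-- A conjugacy preserves the order of the orbit of `0`, or turns it into the reversed order of the
orbit of `1`. -/
lemma ConjugateTo.orbit_order {f g : C(unitI, unitI)} (h : ConjugateTo f g) :
    (∀ m k : ℕ, g^[m] 0 < g^[k] 0 ↔ f^[m] 0 < f^[k] 0) ∨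
      ∀ m k : ℕ, g^[m] 0 < g^[k] 0 ↔ f^[k] 1 < f^[m] 1 := by
  obtain ⟨ψ, hψ⟩ := h
  have hsemi : Semiconj ψ g f := fun x => by rw [hψ, ψ.apply_symm_apply]
  rcases ψ.continuous.strictMono_of_inj_boundedOrder' ψ.injective with hm | hm
  · have h0 : ψ 0 = 0 := by
      obtain ⟨y, hy⟩ := ψ.surjective 0
      exact le_antisymm ((hm.monotone y.2.1).trans hy.le) (ψ 0).2.1
    refine Or.inl fun m k => ?_
    rw [← hm.lt_iff_lt, hsemi.iterate_right m, hsemi.iterate_right k, h0]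
  · have h0 : ψ 0 = 1 := by
      obtain ⟨y, hy⟩ := ψ.surjective 1
      exact le_antisymm (ψ 0).2.2 (hy.ge.trans (hm.antitone y.2.1))
    refine Or.inr fun m k => ?_
    rw [← hm.lt_iff_gt, hsemi.iterate_right m, hsemi.iterate_right k, h0]

lemma exists_both_orders_of_isOpen {V : Set (closure CP)} (hV : IsOpen V) (hne : V.Nonempty) :
    ∃ m k : ℕ, (∃ g ∈ V, (g : C(unitI, unitI))^[m] 0 < (g : C(unitI, unitI))^[k] 0) ∧
      ∃ g ∈ V, (g : C(unitI, unitI))^[k] 0 < (g : C(unitI, unitI))^[m] 0 := by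
  obtain ⟨W, hW, rfl⟩ := isOpen_induced_iff.1 hV
  obtain ⟨x, hx⟩ := hne
  obtain ⟨f, hfW, hf⟩ := mem_closure_iff.1 x.2 W hW hx
  obtain ⟨ε, hε, hball⟩ := Metric.isOpen_iff.1 hW f hfW
  obtain ⟨m, k, ⟨g, hg, hgf, h⟩, ⟨g', hg', hgf', h'⟩⟩ := exists_mem_CP_iterates_both_orders hf hε
  exact ⟨m, k, ⟨⟨g, subset_closure hg⟩, hball hgf, h⟩, ⟨⟨g', subset_closure hg'⟩, hball hgf', h'⟩⟩

lemma isOpen_iterate_lt (m k : ℕ) (x y : unitI) :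
    IsOpen {g : closure CP | (g : C(unitI, unitI))^[m] x < (g : C(unitI, unitI))^[k] y} :=
  isOpen_lt ((continuous_iterate_eval m x).comp continuous_subtype_val)
    ((continuous_iterate_eval k y).comp continuous_subtype_val)

lemma isNowhereDense_orbit_order (Q : ℕ → ℕ → Prop) :
    IsNowhereDense {g : closure CP |
      ∀ m k : ℕ, (g : C(unitI, unitI))^[m] 0 < (g : C(unitI, unitI))^[k] 0 ↔ Q m k} := by
  rw [IsNowhereDense, ← not_nonempty_iff_eq_empty]
  intro hne
  obtain ⟨m, k, ⟨g, hg, hlt⟩, ⟨g', hg', hlt'⟩⟩ := exists_both_orders_of_isOpen isOpen_interior hne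
  obtain ⟨h, hh, hQ⟩ :=
    mem_closure_iff.1 (interior_subset hg) _ (isOpen_iterate_lt m k 0 0) hlt
  obtain ⟨h', hh', hQ'⟩ :=
    mem_closure_iff.1 (interior_subset hg') _ (isOpen_iterate_lt k m 0 0) hlt'
  exact lt_asymm hh ((hQ k m).2 ((hQ' k m).1 hh'))

/-- Conjugacy classes are meagre in `closure CP`. -/
lemma isMeagre_conjugateTo (f : C(unitI, unitI)) :
    IsMeagre {g : closure CP | ConjugateTo f g} :=
  ((isNowhereDense_orbit_order fun m k => f^[m] 0 < f^[k] 0).isMeagre.union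
    (isNowhereDense_orbit_order fun m k => f^[k] 1 < f^[m] 1).isMeagre).mono
      fun _ hg => hg.orbit_order

/-- A non-meagre set meets uncountably many classes of an equivalence relation with meagre
classes. -/
lemma exists_not_countable_pairwise_not_rel {X : Type*} [TopologicalSpace X] (r : Setoid X)
    (hr : ∀ x, IsMeagre {y | r x y}) {G : Set X} (hG : ¬ IsMeagre G) :
    ∃ A ⊆ G, ¬ A.Countable ∧ ∀ x ∈ A, ∀ y ∈ A, x ≠ y → ¬ r x y := by
  let s : Setoid G := r.comap Subtype.val
  refine ⟨range fun q : Quotient s => (q.out : X), ?_, fun hc => hG ?_, ?_⟩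
  · rintro _ ⟨q, rfl⟩
    exact q.out.2
  · refine (isMeagre_biUnion hc (f := fun x => {y | r x y}) fun x _ => hr x).mono fun y hy => ?_
    simp only [mem_iUnion]
    exact ⟨_, ⟨Quotient.mk s ⟨y, hy⟩, rfl⟩, Quotient.mk_out (s := s) ⟨y, hy⟩⟩
  · rintro _ ⟨q, rfl⟩ _ ⟨q', rfl⟩ hne hrel
    exact hne (congrArg (fun q : Quotient s => (q.out : X)) (Quotient.out_equiv_out.1 hrel))

lemma perfect_range_of_cantor {X : Type*} [TopologicalSpace X] [T2Space X]
    {φ : (ℕ → Bool) → X} (hc : Continuous φ) (hi : Injective φ) : Perfect (range φ) := by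
  refine ⟨(isCompact_range hc).isClosed, ?_⟩
  rintro _ ⟨s, rfl⟩
  rw [accPt_iff_nhds]
  intro U hU
  have htend : Filter.Tendsto (fun n : ℕ => update s n (!s n)) Filter.atTop (nhds s) := by
    rw [tendsto_pi_nhds]
    intro k
    refine tendsto_const_nhds.congr' ?_
    filter_upwards [Filter.eventually_gt_atTop k] with n hn
    rw [update_of_ne hn.ne]
  obtain ⟨n, hn⟩ := (htend.eventually (hc.continuousAt hU)).exists
  refine ⟨_, ⟨hn, mem_range_self _⟩, fun h => ?_⟩
  have := congrFun (hi h) n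
  simp at this

open CantorScheme PiNat in
/-- If every nonempty open subset of `U` contains two nonempty open sets that are unrelated by the
reflexive relation `R`, then there is a nonempty perfect set of pairwise unrelated points. -/
lemma exists_perfect_pairwise_not_rel {X : Type*} [MetricSpace X] [CompleteSpace X]
    {R : X → X → Prop} (hR : ∀ x, R x x) {U : Set X} (hU : IsOpen U) (hUne : U.Nonempty)
    (hsplit : ∀ V : Set X, IsOpen V → V.Nonempty → V ⊆ U → ∃ V₀ V₁ : Set X,
      (IsOpen V₀ ∧ V₀.Nonempty ∧ V₀ ⊆ V) ∧ (IsOpen V₁ ∧ V₁.Nonempty ∧ V₁ ⊆ V) ∧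
      ∀ x ∈ V₀, ∀ y ∈ V₁, ¬ R x y ∧ ¬ R y x) :
    ∃ A : Set X, A.Nonempty ∧ Perfect A ∧ ∀ x ∈ A, ∀ y ∈ A, R x y → x = y := by
  obtain ⟨ε, -, εpos', hε⟩ := exists_seq_strictAnti_tendsto' (zero_lt_one' ENNReal)
  have εpos := fun n => (εpos' n).1
  have hsmall : ∀ V : Set X, IsOpen V → V.Nonempty → ∀ δ : ENNReal, 0 < δ → ∃ V' : Set X,
      IsOpen V' ∧ V'.Nonempty ∧ closure V' ⊆ V ∧ ediam V' ≤ δ := by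
    rintro V hV ⟨x, hx⟩ δ hδ
    obtain ⟨ρ, hρ, hsub⟩ := Metric.nhds_basis_closedEBall.mem_iff.1 (hV.mem_nhds hx)
    have hpos : 0 < min ρ (δ / 2) := lt_min hρ (ENNReal.half_pos hδ.ne')
    refine ⟨eball x (min ρ (δ / 2)), isOpen_eball, ⟨x, mem_eball_self hpos⟩, ?_, ?_⟩
    · refine (closure_minimal eball_subset_closedEBall isClosed_closedEBall).trans ?_
      exact (closedEBall_subset_closedEBall (min_le_left _ _)).trans hsub
    · refine ediam_eball_le.trans ?_
      calc 2 * min ρ (δ / 2) ≤ 2 * (δ / 2) := by gcongr; exact min_le_right _ _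
        _ = δ := ENNReal.mul_div_cancel two_ne_zero ENNReal.ofNat_ne_top
  let P := {V : Set X // IsOpen V ∧ V.Nonempty ∧ V ⊆ U}
  have hchildren : ∀ (V : P) (δ : ENNReal), 0 < δ → ∃ c : Bool → P,
      (∀ a, closure (c a).1 ⊆ V.1 ∧ ediam (c a).1 ≤ δ) ∧
      ∀ a b, a ≠ b → ∀ x ∈ (c a).1, ∀ y ∈ (c b).1, ¬ R x y := by
    rintro ⟨V, hV, hVne, hVU⟩ δ hδ
    obtain ⟨V₀, V₁, ⟨ho₀, hn₀, hs₀⟩, ⟨ho₁, hn₁, hs₁⟩, hsep⟩ := hsplit V hV hVne hVU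
    obtain ⟨W₀, hW₀, hWn₀, hcl₀, hd₀⟩ := hsmall V₀ ho₀ hn₀ δ hδ
    obtain ⟨W₁, hW₁, hWn₁, hcl₁, hd₁⟩ := hsmall V₁ ho₁ hn₁ δ hδ
    have h₀ := subset_closure.trans hcl₀
    have h₁ := subset_closure.trans hcl₁
    refine ⟨fun a => bif a then ⟨W₁, hW₁, hWn₁, (h₁.trans hs₁).trans hVU⟩
      else ⟨W₀, hW₀, hWn₀, (h₀.trans hs₀).trans hVU⟩, ?_, ?_⟩
    · rintro (_ | _)
      · exact ⟨hcl₀.trans hs₀, hd₀⟩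
      · exact ⟨hcl₁.trans hs₁, hd₁⟩
    · rintro (_ | _) (_ | _) hab x hx y hy
      · exact absurd rfl hab
      · exact (hsep x (h₀ hx) y (h₁ hy)).1
      · exact (hsep y (h₀ hy) x (h₁ hx)).2
      · exact absurd rfl hab
  choose c hc hcR using hchildren
  let DP : List Bool → P := fun l =>
    List.rec ⟨U, hU, hUne, Subset.rfl⟩ (fun a l V => c V (ε (l.length + 1)) (εpos _) a) l
  let D : List Bool → Set X := fun l => (DP l).1
  have hanti : ClosureAntitone D := fun l a => (hc (DP l) _ (εpos (l.length + 1)) a).1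
  have hdiam : VanishingDiam D := by
    intro x
    refine tendsto_of_tendsto_of_tendsto_of_le_of_le' tendsto_const_nhds hε (by simp) ?_
    filter_upwards [Filter.eventually_ge_atTop 1] with m hm
    obtain ⟨n, rfl⟩ : ∃ n, m = n + 1 := ⟨m - 1, by omega⟩
    have h := (hc (DP (res x n)) _ (εpos ((res x n).length + 1)) (x n)).2
    exact h.trans_eq (by rw [res_length])
  have hdom : ∀ x : ℕ → Bool, x ∈ (inducedMap D).1 := fun x => by
    rw [hanti.map_of_vanishingDiam hdiam fun l => (DP l).2.2.1]
    exact mem_univ x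
  let φ : (ℕ → Bool) → X := fun x => (inducedMap D).2 ⟨x, hdom x⟩
  have hφc : Continuous φ := hdiam.map_continuous.comp (by fun_prop)
  have hmem : ∀ x n, φ x ∈ D (res x n) := fun x n => map_mem ⟨x, hdom x⟩ n
  have hinj : ∀ x y, R (φ x) (φ y) → x = y := by
    intro x y hxy
    apply res_injective
    ext n : 1
    induction n with
    | zero => simp
    | succ n ih =>
      rw [res_succ, res_succ, ih]
      congr 1
      by_contra hne
      have hx := hmem x (n + 1)
      have hy := hmem y (n + 1)
      rw [res_succ] at hx hy
      rw [ih] at hx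
      exact hcR (DP (res y n)) _ (εpos _) _ _ hne _ hx _ hy hxy
  refine ⟨range φ, range_nonempty φ, perfect_range_of_cantor hφc fun x y h => hinj x y ?_, ?_⟩
  · rw [h]
    exact hR _
  · rintro _ ⟨x, rfl⟩ _ ⟨y, rfl⟩ h
    rw [hinj x y h]

/-- Every non-meager (second category) subset of `cl(CP)` contains uncountably many
pairwise non-conjugate maps; moreover there is a nonempty perfect subset of `cl(CP)`
any two distinct elements of which are not topologically conjugate. -/
theorem secondCategory_contains_uncountably_many_conjClasses :
    (∀ G : Set (closure CP : Set C(unitI, unitI)), ¬ IsMeagre G →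
      ∃ A ⊆ G, ¬ A.Countable ∧
        ∀ f ∈ A, ∀ g ∈ A, f ≠ g →
          ¬ ConjugateTo (f : C(unitI, unitI)) (g : C(unitI, unitI))) ∧
    (∃ A : Set (closure CP : Set C(unitI, unitI)), A.Nonempty ∧ Perfect A ∧
      ∀ f ∈ A, ∀ g ∈ A,
        ConjugateTo (f : C(unitI, unitI)) (g : C(unitI, unitI)) → f = g) := by
  constructor
  · intro G hG
    exact exists_not_countable_pairwise_not_rel
      ⟨fun f g : closure CP => ConjugateTo f g,
        ⟨fun f => .refl _, fun h => h.symm, fun h h' => h.trans h'⟩⟩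
      (fun f => isMeagre_conjugateTo f) hG
  · have : CompleteSpace (closure CP) := isClosed_closure.completeSpace_coe
    obtain ⟨g₀, hg₀, h₀, h₁⟩ := exists_mem_CP_endpoints_descend
    refine exists_perfect_pairwise_not_rel
      (R := fun f g : closure CP => ConjugateTo (f : C(unitI, unitI)) (g : C(unitI, unitI)))
      (fun f => .refl _) ((isOpen_iterate_lt 2 1 0 0).inter (isOpen_iterate_lt 2 1 1 1))
      ⟨⟨g₀, subset_closure hg₀⟩, h₀, h₁⟩ fun V hV hVne hVU => ?_
    have hsame : ∀ f ∈ V, ∀ g ∈ V, ConjugateTo (f : C(unitI, unitI)) (g : C(unitI, unitI)) →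
        ∀ m k : ℕ, (g : C(unitI, unitI))^[m] 0 < (g : C(unitI, unitI))^[k] 0 ↔
          (f : C(unitI, unitI))^[m] 0 < (f : C(unitI, unitI))^[k] 0 := by
      intro f hf g hg h
      rcases h.orbit_order with h | h
      · exact h
      · exact (lt_asymm ((h 2 1).1 (hVU hg).1) (hVU hf).2).elim
    obtain ⟨m, k, ⟨g, hg, hlt⟩, ⟨g', hg', hlt'⟩⟩ := exists_both_orders_of_isOpen hV hVne
    refine ⟨_, _, ⟨hV.inter (isOpen_iterate_lt m k 0 0), ⟨g, hg, hlt⟩, inter_subset_left⟩,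
      ⟨hV.inter (isOpen_iterate_lt k m 0 0), ⟨g', hg', hlt'⟩, inter_subset_left⟩, ?_⟩
    rintro x ⟨hx, hxlt⟩ y ⟨hy, hylt⟩
    exact ⟨fun h => lt_asymm hylt ((hsame x hx y hy h m k).2 hxlt),
      fun h => lt_asymm hxlt ((hsame y hy x hx h k m).2 hylt)⟩
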